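/- (Lossless decomposition) Let G = (V, E, W) be a finite undirected weighted graph and T an encoding tree for G. Define the node-level Shapley values φ(u) = (1/vol(V)) · ( ∑_{{u,v}∈E} W(u,v)·log vol(α_{u∨v}) − d(u)·log d(u) ) for each u ∈ V. Then the decomposition is lossless: ∑_{u∈V} φ(u) = H(G,T), the structural entropy of G with respect to T. -/

import Mathlib

open scoped Classical
open Finset

/-- An encoding tree for a graph on vertex set `V`: a finite rooted tree (given by a
parent function under which every node reaches the root) together with a bijection
between its leaves and the elements of `V`, and the least-common-ancestor operation. -/
structure EncodingTree (V : Type) [Fintype V] where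
  /-- the type of tree nodes -/
  N : Type
  fintypeN : Fintype N
  root : N
  parent : N → N
  parent_root : parent root = root
  reaches_root : ∀ α : N, ∃ m : ℕ, parent^[m] α = root
  /-- the leaf corresponding to a graph node -/
  leafOf : V → N
  leafOf_inj : Function.Injective leafOf
  /-- the leaves (nodes without children) are exactly the images of graph nodes -/
  leaf_iff : ∀ α : N, (¬ ∃ β : N, β ≠ root ∧ parent β = α) ↔ α ∈ Set.range leafOf
  /-- least common ancestor -/
  lca : N → N → N
  lca_anc_left : ∀ α β : N, ∃ m : ℕ, parent^[m] α = lca α β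
  lca_anc_right : ∀ α β : N, ∃ m : ℕ, parent^[m] β = lca α β
  lca_min : ∀ α β γ : N, (∃ m : ℕ, parent^[m] α = γ) → (∃ m : ℕ, parent^[m] β = γ) →
      ∃ m : ℕ, parent^[m] (lca α β) = γ

attribute [instance] EncodingTree.fintypeN

variable {V : Type} [Fintype V]

/-- weighted degree `d(x) = ∑_{y} W(x,y)` -/
noncomputable def deg (W : V → V → ℝ) (x : V) : ℝ := ∑ y, W x y

/-- total volume `vol(V) = ∑_{x ∈ V} d(x)` -/
noncomputable def volV (W : V → V → ℝ) : ℝ := ∑ x, deg W x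

namespace EncodingTree

variable (T : EncodingTree V)

/-- the community of a tree node: graph nodes whose leaves are descendants of it -/
noncomputable def community (α : T.N) : Finset V :=
  Finset.univ.filter (fun x => ∃ m : ℕ, T.parent^[m] (T.leafOf x) = α)

/-- `vol(α) = ∑_{x ∈ C(α)} d(x)` -/
noncomputable def vol (W : V → V → ℝ) (α : T.N) : ℝ :=
  ∑ x ∈ T.community α, deg W x

/-- `g(α) = ∑_{x ∈ C(α)} ∑_{y ∉ C(α)} W(x,y)` -/
noncomputable def g (W : V → V → ℝ) (α : T.N) : ℝ :=
  ∑ x ∈ T.community α, ∑ y ∈ (T.community α)ᶜ, W x y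

/-- structural entropy `H(G,T)` -/
noncomputable def H (W : V → V → ℝ) : ℝ :=
  -∑ α ∈ Finset.univ.filter (fun α : T.N => α ≠ T.root),
      (T.g W α / volV W) * Real.log (T.vol W α / T.vol W (T.parent α))

end EncodingTree

namespace EncodingTree

variable (T : EncodingTree V)

lemma iterate_parent_root (n : ℕ) : T.parent^[n] T.root = T.root :=
  Function.iterate_fixed T.parent_root n

/-- The parent function has no cycle other than the loop at the root. -/
lemma eq_root_of_iterate_eq_self {α : T.N} {k : ℕ} (hk : 0 < k)
    (h : T.parent^[k] α = α) : α = T.root := by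
  obtain ⟨n, hn⟩ := T.reaches_root α
  have hper : T.parent^[k * n] α = α := by
    rw [Function.iterate_mul]
    exact Function.iterate_fixed h n
  have hle : n ≤ k * n := Nat.le_mul_of_pos_left n hk
  rw [← Nat.sub_add_cancel hle, Function.iterate_add_apply, hn, iterate_parent_root] at hper
  exact hper.symm

/-- The ancestor relation is antisymmetric. -/
lemma eq_of_iterate_eq_of_iterate_eq {α β : T.N} {m n : ℕ}
    (hm : T.parent^[m] α = β) (hn : T.parent^[n] β = α) : α = β := by
  rcases Nat.eq_zero_or_pos m with rfl | hpos
  · exact hm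
  · have hα : α = T.root := T.eq_root_of_iterate_eq_self (k := n + m) (by omega) (by
      rw [Function.iterate_add_apply, hm, hn])
    subst hα
    rw [← hm, iterate_parent_root]

/-- A leaf has no descendant other than itself. -/
lemma eq_leafOf_of_iterate_eq {x : V} (m : ℕ) {α : T.N}
    (h : T.parent^[m] α = T.leafOf x) : α = T.leafOf x := by
  induction m generalizing α with
  | zero => exact h
  | succ m ih =>
    have hp : T.parent α = T.leafOf x := ih h
    by_cases hα : α = T.root
    · rw [← hp, hα, T.parent_root]
    · exact absurd ⟨α, hα, hp⟩ ((T.leaf_iff (T.leafOf x)).2 ⟨x, rfl⟩)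

lemma mem_community {α : T.N} {x : V} :
    x ∈ T.community α ↔ ∃ m : ℕ, T.parent^[m] (T.leafOf x) = α := by
  simp [community]

lemma community_leafOf (x : V) : T.community (T.leafOf x) = {x} := by
  ext y
  rw [mem_community, Finset.mem_singleton]
  constructor
  · rintro ⟨m, hm⟩
    exact T.leafOf_inj (T.eq_leafOf_of_iterate_eq m hm)
  · rintro rfl
    exact ⟨0, rfl⟩

lemma vol_leafOf (W : V → V → ℝ) (x : V) : T.vol W (T.leafOf x) = deg W x := by
  simp [vol, community_leafOf]

lemma vol_pos_of_mem {W : V → V → ℝ} (hdeg : ∀ x, 0 < deg W x) {α : T.N} {x : V}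
    (hx : x ∈ T.community α) : 0 < T.vol W α :=
  Finset.sum_pos (fun y _ => hdeg y) ⟨x, hx⟩

lemma mem_community_parent {α : T.N} {x : V} (hx : x ∈ T.community α) :
    x ∈ T.community (T.parent α) := by
  obtain ⟨m, hm⟩ := T.mem_community.1 hx
  exact T.mem_community.2 ⟨m + 1, by rw [Function.iterate_succ_apply', hm]⟩

/-- Summing the increments of `f` along the tree nodes that separate `x` from `y`
telescopes to the difference between the values at the least common ancestor and at the
leaf of `x`. -/
lemma sum_separating_sub (f : T.N → ℝ) (x y : V) :
    ∑ α ∈ univ.filter (fun α : T.N => α ≠ T.root ∧ x ∈ T.community α ∧ y ∉ T.community α),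
        (f (T.parent α) - f α)
      = f (T.lca (T.leafOf x) (T.leafOf y)) - f (T.leafOf x) := by
  set c := T.lca (T.leafOf x) (T.leafOf y) with hc
  have hex := T.lca_anc_left (T.leafOf x) (T.leafOf y)
  rw [← hc] at hex
  obtain ⟨m, hm, hmin⟩ : ∃ m : ℕ, T.parent^[m] (T.leafOf x) = c ∧
      ∀ i < m, T.parent^[i] (T.leafOf x) ≠ c :=
    ⟨Nat.find hex, Nat.find_spec hex, fun i hi => Nat.find_min hex hi⟩
  have hroot : ∀ i < m, T.parent^[i] (T.leafOf x) ≠ T.root := by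
    intro i hi h
    apply hmin i hi
    rw [← hm, ← Nat.sub_add_cancel hi.le, Function.iterate_add_apply, h, iterate_parent_root]
  have hne : ∀ i j, i < j → j < m →
      T.parent^[i] (T.leafOf x) ≠ T.parent^[j] (T.leafOf x) := by
    intro i j hij hj h
    refine hroot i (hij.trans hj) (T.eq_root_of_iterate_eq_self (k := j - i) (by omega) ?_)
    rw [← Function.iterate_add_apply, Nat.sub_add_cancel hij.le, h]
  have hset : univ.filter
        (fun α : T.N => α ≠ T.root ∧ x ∈ T.community α ∧ y ∉ T.community α)
      = (range m).image (fun i => T.parent^[i] (T.leafOf x)) := by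
    ext α
    simp only [Finset.mem_filter, Finset.mem_univ, true_and, Finset.mem_image, Finset.mem_range]
    constructor
    · rintro ⟨-, hx, hy⟩
      obtain ⟨i, hi⟩ := T.mem_community.1 hx
      refine ⟨i, ?_, hi⟩
      by_contra! hmi
      obtain ⟨n, hn⟩ := T.lca_anc_right (T.leafOf x) (T.leafOf y)
      refine hy (T.mem_community.2 ⟨i - m + n, ?_⟩)
      rw [Function.iterate_add_apply, hn, ← hc, ← hm, ← Function.iterate_add_apply,
        Nat.sub_add_cancel hmi, hi]
    · rintro ⟨i, hi, rfl⟩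
      refine ⟨hroot i hi, T.mem_community.2 ⟨i, rfl⟩, fun hy => hmin i hi ?_⟩
      obtain ⟨n, hn⟩ := T.lca_min _ _ _ ⟨i, rfl⟩ (T.mem_community.1 hy)
      refine T.eq_of_iterate_eq_of_iterate_eq (m := m - i) ?_ hn
      rw [← Function.iterate_add_apply, Nat.sub_add_cancel hi.le, hm]
  rw [hset, Finset.sum_image]
  · rw [← hm]
    simp_rw [← Function.iterate_succ_apply' T.parent]
    exact Finset.sum_range_sub (fun i => f (T.parent^[i] (T.leafOf x))) m
  · intro i hi j hj h
    have hi' : i < m := by simpa using hi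
    have hj' : j < m := by simpa using hj
    rcases lt_trichotomy i j with hij | hij | hij
    · exact absurd h (hne i j hij hj')
    · exact hij
    · exact absurd h.symm (hne j i hij hi')

lemma g_mul_log_eq_sum {W : V → V → ℝ} (hdeg : ∀ x, 0 < deg W x) (α : T.N) :
    -(T.g W α * Real.log (T.vol W α / T.vol W (T.parent α)))
      = ∑ x, ∑ y, if x ∈ T.community α ∧ y ∉ T.community α then
          W x y * (Real.log (T.vol W (T.parent α)) - Real.log (T.vol W α)) else 0 := by
  have hlog : ∀ x ∈ T.community α, Real.log (T.vol W (T.parent α)) - Real.log (T.vol W α)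
      = -Real.log (T.vol W α / T.vol W (T.parent α)) := by
    intro x hx
    rw [Real.log_div (T.vol_pos_of_mem hdeg hx).ne'
      (T.vol_pos_of_mem hdeg (T.mem_community_parent hx)).ne']
    ring
  rw [g, ← mul_neg, Finset.sum_mul, ← Finset.sum_subset (Finset.subset_univ (T.community α))]
  · refine Finset.sum_congr rfl fun x hx => ?_
    rw [Finset.sum_mul, ← Finset.sum_filter]
    refine Finset.sum_congr (by ext y; simp [hx]) fun y _ => ?_
    rw [hlog x hx]
  · intro x _ hx
    simp [hx]

/-- The structural entropy as a sum over pairs of graph nodes. -/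
lemma H_eq_sum_lca {W : V → V → ℝ} (hdeg : ∀ x, 0 < deg W x) :
    T.H W = (1 / volV W) * ∑ x, ∑ y, W x y *
      (Real.log (T.vol W (T.lca (T.leafOf x) (T.leafOf y))) - Real.log (deg W x)) := by
  have hpair : ∀ x y, W x y *
      (Real.log (T.vol W (T.lca (T.leafOf x) (T.leafOf y))) - Real.log (deg W x))
      = ∑ α ∈ univ.filter (fun α : T.N => α ≠ T.root),
          if x ∈ T.community α ∧ y ∉ T.community α then
            W x y * (Real.log (T.vol W (T.parent α)) - Real.log (T.vol W α)) else 0 := by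
    intro x y
    rw [← T.vol_leafOf W x, ← T.sum_separating_sub (fun α => Real.log (T.vol W α)) x y,
      Finset.mul_sum, ← Finset.sum_filter, Finset.filter_filter]
  simp_rw [hpair]
  rw [Finset.sum_congr rfl fun x _ => Finset.sum_comm, Finset.sum_comm, Finset.mul_sum, H,
    ← Finset.sum_neg_distrib]
  refine Finset.sum_congr rfl fun α _ => ?_
  rw [← T.g_mul_log_eq_sum hdeg α]
  ring

end EncodingTree

/-- **Lossless decomposition.** With the node-level Shapley values
`φ(u) = (1/vol(V)) · (∑_{{u,v}∈E} W(u,v)·log vol(α_{u∨v}) − d(u)·log d(u))`,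
the decomposition is lossless: `∑_{u∈V} φ(u) = H(G,T)`. -/
theorem shapley_decomposition_lossless
    [Nonempty V] (W : V → V → ℝ) (T : EncodingTree V)
    (hsymm : ∀ x y, W x y = W y x)
    (hdiag : ∀ x, W x x = 0)
    (hnonneg : ∀ x y, 0 ≤ W x y)
    (hdeg : ∀ x, 0 < deg W x)
    (φ : V → ℝ)
    (hφ : ∀ u : V, φ u = (1 / volV W) *
      ((∑ v ∈ Finset.univ.filter (fun v => 0 < W u v),
          W u v * Real.log (T.vol W (T.lca (T.leafOf u) (T.leafOf v))))
        - deg W u * Real.log (deg W u))) :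
    ∑ u, φ u = T.H W := by
  rw [T.H_eq_sum_lca hdeg, Finset.mul_sum]
  refine Finset.sum_congr rfl fun u _ => ?_
  rw [hφ u, Finset.sum_filter_of_ne fun v _ hv =>
    (hnonneg u v).lt_of_ne' (left_ne_zero_of_mul hv)]
  simp_rw [mul_sub]
  rw [Finset.sum_sub_distrib, ← Finset.sum_mul, ← deg, mul_sub]
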